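/- Assume a(v,v) ≥ 0 for all v ∈ V, so that |||v||| = (β^(1/2)·a(v,v) + ‖v‖²)^(1/2) is well defined. Then for every pair (p,y) ∈ V × V with (p,y) ≠ (0,0) there exists a pair (q,z) ∈ V × V with (q,z) ≠ (0,0) such that (|||p||| + |||y|||)·(|||q||| + |||z|||) ≤ 2·√2 · B((p,y),(q,z)). In other words, B satisfies the inf-sup condition |||p||| + |||y||| ≤ 2√2 · sup_{(q,z)≠0} B((p,y),(q,z))/(|||q||| + |||z|||). (This is the abstract content of Lemma 3.3 of the paper, proved by choosing (q,z) = (y+p, y−p) and the parallelogram law.) -/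

import Mathlib

open RealInnerProductSpace

/-- The coupled bilinear form `B((p,y),(q,z)) = β^(1/2)·a(q,p) + ⟨y,q⟩ − ⟨p,z⟩ + β^(1/2)·a(y,z)`. -/
noncomputable def couplingB {V : Type*} [NormedAddCommGroup V] [InnerProductSpace ℝ V]
    (a : V →ₗ[ℝ] V →ₗ[ℝ] ℝ) (β : ℝ) (py qz : V × V) : ℝ :=
  Real.sqrt β * a qz.1 py.1 + ⟪py.2, qz.1⟫ - ⟪py.1, qz.2⟫ + Real.sqrt β * a py.2 qz.2

/-- The β-scaled energy norm `|||v||| = (β^(1/2)·a(v,v) + ‖v‖²)^(1/2)`. -/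
noncomputable def energyNorm {V : Type*} [NormedAddCommGroup V] [InnerProductSpace ℝ V]
    (a : V →ₗ[ℝ] V →ₗ[ℝ] ℝ) (β : ℝ) (v : V) : ℝ :=
  Real.sqrt (Real.sqrt β * a v v + ‖v‖ ^ 2)

theorem energyNorm_sq {V : Type*} [NormedAddCommGroup V] [InnerProductSpace ℝ V]
    (a : V →ₗ[ℝ] V →ₗ[ℝ] ℝ) (β : ℝ) {v : V} (hv : 0 ≤ a v v) :
    energyNorm a β v ^ 2 = Real.sqrt β * a v v + ‖v‖ ^ 2 :=
  Real.sq_sqrt (by positivity)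

/-- Parallelogram law for the energy norm. -/
theorem energyNorm_add_sq_add_energyNorm_sub_sq {V : Type*} [NormedAddCommGroup V]
    [InnerProductSpace ℝ V] (a : V →ₗ[ℝ] V →ₗ[ℝ] ℝ) (β : ℝ) (ha : ∀ v : V, 0 ≤ a v v) (x y : V) :
    energyNorm a β (x + y) ^ 2 + energyNorm a β (x - y) ^ 2 =
      2 * (energyNorm a β x ^ 2 + energyNorm a β y ^ 2) := by
  have h := parallelogram_law_with_norm ℝ x y
  simp only [energyNorm_sq a β (ha _), map_add, map_sub, LinearMap.add_apply,
    LinearMap.sub_apply]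
  linear_combination h

theorem couplingB_add_sub {V : Type*} [NormedAddCommGroup V] [InnerProductSpace ℝ V]
    (a : V →ₗ[ℝ] V →ₗ[ℝ] ℝ) (β : ℝ) (ha : ∀ v : V, 0 ≤ a v v) (p y : V) :
    couplingB a β (p, y) (y + p, y - p) = energyNorm a β p ^ 2 + energyNorm a β y ^ 2 := by
  simp only [couplingB, energyNorm_sq a β (ha _), map_add, map_sub, LinearMap.add_apply,
    inner_add_right, inner_sub_right, real_inner_self_eq_norm_sq, real_inner_comm y p]
  ring

/-- The inf-sup condition (abstract content of Lemma 3.3): assuming `a(v,v) ≥ 0` for all `v`,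
for every `(p,y) ≠ (0,0)` there exists `(q,z) ≠ (0,0)` with
`(|||p||| + |||y|||)·(|||q||| + |||z|||) ≤ 2√2 · B((p,y),(q,z))`. -/
theorem couplingB_infSup {V : Type*} [NormedAddCommGroup V] [InnerProductSpace ℝ V]
    (a : V →ₗ[ℝ] V →ₗ[ℝ] ℝ) (β : ℝ) (hβ : 0 < β)
    (ha : ∀ v : V, 0 ≤ a v v)
    (p y : V) (hpy : (p, y) ≠ (0, 0)) :
    ∃ q z : V, (q, z) ≠ ((0 : V), (0 : V)) ∧
      (energyNorm a β p + energyNorm a β y) * (energyNorm a β q + energyNorm a β z)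
        ≤ 2 * Real.sqrt 2 * couplingB a β (p, y) (q, z) := by
  refine ⟨y + p, y - p, ?_, ?_⟩
  · intro h
    obtain ⟨h_add, h_sub⟩ := Prod.mk.inj h
    obtain rfl : y = p := sub_eq_zero.mp h_sub
    have hy : y = 0 := by simpa [← two_smul ℝ y] using h_add
    exact hpy (by rw [hy])
  · rw [couplingB_add_sub a β ha]
    have h := energyNorm_add_sq_add_energyNorm_sub_sq a β ha y p
    set P := energyNorm a β p
    set Y := energyNorm a β y
    set Q := energyNorm a β (y + p)
    set Z := energyNorm a β (y - p)
    have h_left : (P + Y) ^ 2 ≤ 2 * (P ^ 2 + Y ^ 2) := add_sq_le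
    have h_right : (Q + Z) ^ 2 ≤ 4 * (P ^ 2 + Y ^ 2) := by
      linarith [add_sq_le (a := Q) (b := Z)]
    refine (abs_le_of_sq_le_sq' ?_ (by positivity)).2
    calc ((P + Y) * (Q + Z)) ^ 2 = (P + Y) ^ 2 * (Q + Z) ^ 2 := mul_pow _ _ _
      _ ≤ 2 * (P ^ 2 + Y ^ 2) * (4 * (P ^ 2 + Y ^ 2)) := by gcongr
      _ = (2 * Real.sqrt 2 * (P ^ 2 + Y ^ 2)) ^ 2 := by
        rw [mul_pow, mul_pow, Real.sq_sqrt zero_le_two]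
        ring
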